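/- arXiv:1412.2253 — 3 statements merged into one kernel-verified Lean document; each statement's English description precedes it below -/
import Mathlib

section
/- Let A be a nontrivial pseudo BL-algebra in which every maximal filter is normal. Then for every n ≥ 1, all x₁, …, xₙ ∈ A and every permutation π of {1, …, n}: ((x₁·⋯·xₙ)⁻)² ≤ (x_{π(1)}²·⋯·x_{π(n)}²)⁻. -/
/-- A pseudo BL-algebra: a bounded lattice `(A; ∨, ∧, 0, 1)` together with a monoid
structure `(A; ·, 1)` and two residua `→` (`himp`) and `⇝` (`rimp`) satisfying the
residuation, divisibility and prelinearity conditions. -/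
class PseudoBL (A : Type*) extends Lattice A, Monoid A, Zero A where
  himp : A → A → A
  rimp : A → A → A
  zero_le : ∀ x : A, (0 : A) ≤ x
  le_one : ∀ x : A, x ≤ 1
  mul_le_iff_himp : ∀ x y z : A, x * y ≤ z ↔ x ≤ himp y z
  mul_le_iff_rimp : ∀ x y z : A, x * y ≤ z ↔ y ≤ rimp x z
  himp_mul_inf : ∀ x y : A, himp x y * x = x ⊓ y
  mul_rimp_inf : ∀ x y : A, y * rimp y x = x ⊓ y
  prelin_himp : ∀ x y : A, himp x y ⊔ himp y x = 1
  prelin_rimp : ∀ x y : A, rimp x y ⊔ rimp y x = 1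

namespace PseudoBL

variable {A : Type*} [PseudoBL A]

/-- The left negation `x⁻ := x → 0`. -/
def lneg (x : A) : A := himp x 0

/-- A filter: a nonempty subset closed under `·` and upward closed. -/
def IsFilter (F : Set A) : Prop :=
  F.Nonempty ∧ (∀ x ∈ F, ∀ y ∈ F, x * y ∈ F) ∧ ∀ x ∈ F, ∀ y : A, x ≤ y → y ∈ F

/-- A maximal filter: a proper filter not properly contained in any proper filter. -/
def IsMaximalFilter (F : Set A) : Prop :=
  IsFilter F ∧ F ≠ Set.univ ∧
    ∀ G : Set A, IsFilter G → G ≠ Set.univ → F ⊆ G → F = G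

/-- A normal filter: `x→y ∈ F` iff `x⇝y ∈ F`. -/
def IsNormalFilter (F : Set A) : Prop :=
  ∀ x y : A, himp x y ∈ F ↔ rimp x y ∈ F

end PseudoBL

namespace PseudoBL

section basic
variable {A : Type*} [PseudoBL A]

theorem mulL {x y : A} (z : A) (h : x ≤ y) : z * x ≤ z * y := by
  rw [mul_le_iff_rimp]
  exact h.trans ((mul_le_iff_rimp z y (z * y)).1 le_rfl)

theorem mulR {x y : A} (z : A) (h : x ≤ y) : x * z ≤ y * z := by
  rw [mul_le_iff_himp]
  exact h.trans ((mul_le_iff_himp y z (y * z)).1 le_rfl)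

theorem mul2 {x y z w : A} (h : x ≤ y) (k : z ≤ w) : x * z ≤ y * w :=
  (mulR z h).trans (mulL y k)

theorem mul_le_l (x y : A) : x * y ≤ x := by
  simpa using mulL x (le_one y)

theorem mul_le_r (x y : A) : x * y ≤ y := by
  simpa using mulR y (le_one x)

theorem mul_sup_le (x y z w : A) (h : z * w ≤ y) (h1 : z * x ≤ y) : z * (w ⊔ x) ≤ y := by
  rw [mul_le_iff_rimp] at *
  exact sup_le h h1

theorem sup_mul_sup_le (w s t : A) : (s ⊔ w) * (t ⊔ w) ≤ s * t ⊔ w := by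
  rw [mul_le_iff_himp]
  apply sup_le
  · rw [← mul_le_iff_himp]
    exact mul_sup_le _ _ _ _ le_sup_left ((mul_le_r _ _).trans le_sup_right)
  · rw [← mul_le_iff_himp]
    exact (mul_le_l _ _).trans le_sup_right

theorem rimp_mul (x y z : A) : rimp (x * y) z = rimp y (rimp x z) := by
  apply le_antisymm
  · rw [← mul_le_iff_rimp, ← mul_le_iff_rimp, ← mul_assoc, mul_le_iff_rimp]
  · rw [← mul_le_iff_rimp, mul_assoc, mul_le_iff_rimp, mul_le_iff_rimp]

theorem himp_mul (x y z : A) : himp (x * y) z = himp x (himp y z) := by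
  apply le_antisymm
  · rw [← mul_le_iff_himp, ← mul_le_iff_himp, mul_assoc, mul_le_iff_himp]
  · rw [← mul_le_iff_himp, ← mul_assoc, mul_le_iff_himp, mul_le_iff_himp]

theorem IsFilter.one_mem {F : Set A} (h : IsFilter F) : (1 : A) ∈ F := by
  obtain ⟨⟨x, hx⟩, _, hu⟩ := h
  exact hu x hx 1 (le_one x)

theorem IsFilter.ne_univ_iff {F : Set A} (h : IsFilter F) : F ≠ Set.univ ↔ (0 : A) ∉ F := by
  constructor
  · intro hne h0
    exact hne (Set.eq_univ_of_forall fun x => h.2.2 0 h0 x (zero_le x))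
  · rintro h0 rfl
    exact h0 trivial

/-- Every proper filter is contained in a maximal one. -/
theorem exists_maximal {F : Set A} (hF : IsFilter F) (h0 : (0 : A) ∉ F) :
    ∃ M : Set A, IsMaximalFilter M ∧ F ⊆ M := by
  obtain ⟨M, hFM, hM⟩ := zorn_subset_nonempty {G : Set A | IsFilter G ∧ (0 : A) ∉ G}
    (by
      intro c hc hch hne
      refine ⟨⋃₀ c, ⟨⟨?_, ?_, ?_⟩, ?_⟩, fun s hs => Set.subset_sUnion_of_mem hs⟩
      · obtain ⟨G, hG⟩ := hne
        exact ⟨1, G, hG, (hc hG).1.one_mem⟩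
      · rintro x ⟨G, hG, hx⟩ y ⟨H, hH, hy⟩
        rcases hch.total hG hH with h | h
        · exact ⟨H, hH, (hc hH).1.2.1 x (h hx) y hy⟩
        · exact ⟨G, hG, (hc hG).1.2.1 x hx y (h hy)⟩
      · rintro x ⟨G, hG, hx⟩ y hxy
        exact ⟨G, hG, (hc hG).1.2.2 x hx y hxy⟩
      · rintro ⟨G, hG, hx⟩
        exact (hc hG).2 hx) F ⟨hF, h0⟩
  refine ⟨M, ⟨hM.prop.1, (hM.prop.1.ne_univ_iff).2 hM.prop.2, ?_⟩, hFM⟩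
  intro G hG hGu hMG
  exact subset_antisymm hMG (hM.le_of_ge ⟨hG, hG.ne_univ_iff.1 hGu⟩ hMG)

/-- The filter of elements co-complementary to `w`. -/
theorem isFilter_sup {M : Set A} (hM : IsFilter M) (w : A) :
    IsFilter {z : A | z ⊔ w ∈ M} := by
  refine ⟨⟨1, ?_⟩, ?_, ?_⟩
  · exact hM.2.2 _ hM.one_mem _ le_sup_left
  · intro x hx y hy
    exact hM.2.2 _ (hM.2.1 _ hx _ hy) _ (sup_mul_sup_le w x y)
  · intro x hx y hxy
    exact hM.2.2 _ hx _ (sup_le_sup_right hxy w)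

theorem IsMaximalFilter.prime {M : Set A} (hM : IsMaximalFilter M) {u v : A}
    (h : u ⊔ v ∈ M) : u ∈ M ∨ v ∈ M := by
  by_cases hv : v ∈ M
  · exact Or.inr hv
  left
  have hG := isFilter_sup hM.1 v
  have := hM.2.2 _ hG (hG.ne_univ_iff.2 (by
    simpa [sup_eq_right.2 (zero_le v)] using hv)) (fun z hz => hM.1.2.2 z hz _ le_sup_left)
  rw [this]
  exact h

end basic

section quot
variable {A : Type*} [PseudoBL A] {M : Set A}

/-- The preorder of the quotient by `M`. -/
def qle (M : Set A) (x y : A) : Prop := himp x y ∈ M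

theorem qle_of_le (hM : IsMaximalFilter M) {x y : A} (h : x ≤ y) : qle M x y := by
  refine hM.1.2.2 1 hM.1.one_mem _ ?_
  rw [← mul_le_iff_himp, one_mul]
  exact h

theorem qle_trans (hM : IsMaximalFilter M) {x y z : A} (h : qle M x y) (k : qle M y z) :
    qle M x z := by
  refine hM.1.2.2 _ (hM.1.2.1 _ k _ h) _ ?_
  rw [← mul_le_iff_himp, mul_assoc, himp_mul_inf]
  refine (mulL _ inf_le_right).trans ?_
  rw [himp_mul_inf]
  exact inf_le_right

theorem qle_mulR (hM : IsMaximalFilter M) {x y : A} (z : A) (h : qle M x y) :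
    qle M (x * z) (y * z) := by
  refine hM.1.2.2 _ h _ ?_
  rw [← mul_le_iff_himp, ← mul_assoc, himp_mul_inf]
  exact mulR z inf_le_right

theorem qle_mulL (hM : IsMaximalFilter M) (hN : IsNormalFilter M) {x y : A} (z : A)
    (h : qle M x y) : qle M (z * x) (z * y) := by
  unfold qle at *
  rw [hN] at *
  refine hM.1.2.2 _ h _ ?_
  rw [← mul_le_iff_rimp, mul_assoc, mul_rimp_inf]
  exact mulL z inf_le_left

theorem qle_mul (hM : IsMaximalFilter M) (hN : IsNormalFilter M) {x y z w : A}
    (h : qle M x y) (k : qle M z w) : qle M (x * z) (y * w) :=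
  qle_trans hM (qle_mulR hM z h) (qle_mulL hM hN y k)

theorem qle_total (hM : IsMaximalFilter M) (x y : A) : qle M x y ∨ qle M y x := by
  apply hM.prime
  rw [prelin_himp]
  exact hM.1.one_mem

theorem qle_rimp (hN : IsNormalFilter M) (x y z : A) :
    qle M (x * y) z ↔ qle M y (rimp x z) := by
  unfold qle
  rw [hN, hN, rimp_mul]

theorem qle_himp (x y z : A) : qle M (x * y) z ↔ qle M x (himp y z) := by
  unfold qle
  rw [himp_mul]

theorem one_qle {x : A} : qle M 1 x ↔ x ∈ M := by
  have : himp 1 x = x := by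
    apply le_antisymm
    · have := (mul_le_iff_himp (himp 1 x) 1 x).2 le_rfl
      rwa [mul_one] at this
    · rw [← mul_le_iff_himp, mul_one]
  unfold qle
  rw [this]

theorem not_one_qle_zero (hM : IsMaximalFilter M) : ¬ qle M 1 0 := by
  rw [one_qle]
  exact hM.1.ne_univ_iff.1 hM.2.1

theorem qle_arch (hM : IsMaximalFilter M) (hN : IsNormalFilter M) {u : A} (hu : ¬ qle M 1 u) :
    ∃ k : ℕ, qle M (u ^ k) 0 := by
  by_contra hcon
  have hG : IsFilter {z : A | ∃ k : ℕ, qle M (u ^ k) z} := by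
    refine ⟨⟨1, 0, qle_of_le hM (le_one _)⟩, ?_, ?_⟩
    · rintro x ⟨k, hk⟩ y ⟨l, hl⟩
      exact ⟨k + l, by rw [pow_add]; exact qle_mul hM hN hk hl⟩
    · rintro x ⟨k, hk⟩ y hxy
      exact ⟨k, qle_trans hM hk (qle_of_le hM hxy)⟩
  have := hM.2.2 _ hG (hG.ne_univ_iff.2 hcon) (fun z hz => ⟨0, by rw [pow_zero]; exact one_qle.2 hz⟩)
  apply hu
  rw [one_qle, this]
  exact ⟨1, qle_of_le hM (by rw [pow_one])⟩

/-- Density of double negation fails below one: if `u∼` is zero mod `M`, then `u` is one. -/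
theorem mem_of_rneg (hM : IsMaximalFilter M) (hN : IsNormalFilter M) {u : A}
    (h : qle M (rimp u 0) 0) : u ∈ M := by
  rw [← one_qle]
  by_contra hu
  obtain ⟨k, hk⟩ := qle_arch hM hN hu
  induction k with
  | zero => exact not_one_qle_zero hM (by simpa using hk)
  | succ k ih =>
    rw [pow_succ', qle_rimp hN] at hk
    exact ih (qle_trans hM hk h)

/-- Sandwich between powers. -/
theorem exists_pow (hM : IsMaximalFilter M) (hN : IsNormalFilter M) {t : A}
    (ht : ¬ qle M 1 t) (x : A) (hx : ¬ qle M 1 x) :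
    ∃ k : ℕ, qle M (t ^ (k + 1)) x ∧ qle M x (t ^ k) ∧ ¬ qle M (t ^ k) x := by
  classical
  have hex : ∃ k : ℕ, qle M (t ^ k) x := by
    obtain ⟨k, hk⟩ := qle_arch hM hN ht
    exact ⟨k, qle_trans hM hk (qle_of_le hM (zero_le x))⟩
  have h1 := Nat.find_spec hex
  have h2 := fun m => Nat.find_min hex (m := m)
  revert h1 h2
  generalize Nat.find hex = k
  intro h1 h2
  cases k with
  | zero => exact absurd (by simpa using h1) hx
  | succ k =>
    have h3 := h2 k (Nat.lt_succ_self k)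
    exact ⟨k, h1, (qle_total hM _ _).resolve_right h3, h3⟩

/-- Divisibility below: if `s < r` then `s ≼ r * q` with `q < 1`. -/
theorem exists_div (hM : IsMaximalFilter M) (hN : IsNormalFilter M) {r s : A}
    (h : qle M s r) (h' : ¬ qle M r s) : ∃ q, qle M s (r * q) ∧ ¬ qle M 1 q := by
  refine ⟨rimp r s, ?_, ?_⟩
  · rw [mul_rimp_inf]
    refine qle_trans hM ?_ (qle_of_le hM (himp_mul_inf s r).le)
    refine qle_trans hM ?_ (qle_mulR hM s (one_qle.2 h))
    rw [one_mul]
    exact qle_of_le hM le_rfl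
  · rwa [one_qle, ← hN]

/-- The quotient by a maximal normal filter is commutative. -/
theorem qle_comm (hM : IsMaximalFilter M) (hN : IsNormalFilter M) (x y : A) :
    qle M (x * y) (y * x) := by
  have rfl' : ∀ z : A, qle M z z := fun z => qle_of_le hM le_rfl
  by_cases hx : qle M 1 x
  · refine qle_trans hM (qle_of_le hM (mul_le_r x y)) ?_
    simpa using qle_mulL hM hN y hx
  by_cases hy : qle M 1 y
  · refine qle_trans hM (qle_of_le hM (mul_le_l x y)) ?_
    simpa using qle_mulR hM x hy
  by_cases hdisc : ∃ e : A, ¬ qle M 1 e ∧ ∀ q, ¬ qle M 1 q → qle M q e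
  · obtain ⟨e, he, hmax⟩ := hdisc
    have key : ∀ z, ¬ qle M 1 z → ∃ k : ℕ, qle M (e ^ k) z ∧ qle M z (e ^ k) := by
      intro z hz
      obtain ⟨k, h1, h2, h3⟩ := exists_pow hM hN he z hz
      obtain ⟨q, hq, hq1⟩ := exists_div hM hN h2 h3
      refine ⟨k + 1, h1, qle_trans hM hq ?_⟩
      rw [pow_succ]
      exact qle_mulL hM hN _ (hmax q hq1)
    obtain ⟨k, hk1, hk2⟩ := key x hx
    obtain ⟨l, hl1, hl2⟩ := key y hy
    refine qle_trans hM (qle_mul hM hN hk2 hl2) ?_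
    rw [← pow_add, add_comm, pow_add]
    exact qle_mul hM hN hl1 hk1
  · push Not at hdisc
    by_contra hcon
    have hs : ¬ qle M 1 (rimp (x * y) (y * x)) := by
      rw [← qle_rimp hN, mul_one]
      exact hcon
    obtain ⟨r, hr1, hr⟩ := hdisc _ hs
    obtain ⟨r', hr1', hr'⟩ := hdisc r hr1
    obtain ⟨q, hq, hq1⟩ := exists_div hM hN ((qle_total hM _ _).resolve_left hr') hr'
    have ht : ∃ t, ¬ qle M 1 t ∧ qle M r (t * t) := by
      rcases qle_total hM r' q with h | h
      · exact ⟨q, hq1, qle_trans hM hq (qle_mulR hM q h)⟩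
      · exact ⟨r', hr1', qle_trans hM hq (qle_mulL hM hN r' h)⟩
    obtain ⟨t, ht1, ht⟩ := ht
    obtain ⟨m, hm1, hm2, -⟩ := exists_pow hM hN ht1 x hx
    obtain ⟨n, hn1, hn2, -⟩ := exists_pow hM hN ht1 y hy
    apply hr
    rw [← qle_rimp hN]
    refine qle_trans hM (qle_mul hM hN (qle_mul hM hN hm2 hn2) ht) ?_
    have : t ^ m * t ^ n * (t * t) = t ^ (n + 1) * t ^ (m + 1) := by
      rw [← pow_two, ← pow_add, ← pow_add, ← pow_add]
      congr 1
      omega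
    rw [this]
    exact qle_mul hM hN hn1 hm1

theorem qle_perm (hM : IsMaximalFilter M) (hN : IsNormalFilter M) {l l' : List A}
    (h : l.Perm l') : qle M l.prod l'.prod := by
  induction h with
  | nil => exact qle_of_le hM le_rfl
  | cons x _ ih =>
    rw [List.prod_cons, List.prod_cons]
    exact qle_mulL hM hN x ih
  | swap x y l =>
    simp only [List.prod_cons, ← mul_assoc]
    exact qle_mulR hM _ (qle_comm hM hN _ _)
  | trans _ _ ih1 ih2 => exact qle_trans hM ih1 ih2

theorem prod_sq_le (l : List A) : (l.map (fun z => z ^ 2)).prod ≤ l.prod := by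
  induction l with
  | nil => simp
  | cons x l ih =>
    rw [List.map_cons, List.prod_cons, List.prod_cons, pow_two]
    exact mul2 (mul_le_l x x) ih

theorem prod_mem (hM : IsFilter M) (l : List A) (h : ∀ z ∈ l, z ∈ M) : l.prod ∈ M := by
  induction l with
  | nil => simpa using hM.one_mem
  | cons x l ih =>
    rw [List.prod_cons]
    exact hM.2.1 _ (h x (by simp)) _ (ih fun z hz => h z (by simp [hz]))

theorem main_aux (hnorm : ∀ F : Set A, IsMaximalFilter F → IsNormalFilter F)
    (K L : List A) (hKL : K.Perm L) :
    lneg K.prod ^ 2 ≤ lneg (L.map (fun z => z ^ 2)).prod := by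
  set a := K.prod with ha
  set b := (L.map (fun z => z ^ 2)).prod with hb
  set c := lneg a ^ 2 * b with hc
  have hna : lneg a * a ≤ 0 := (mul_le_iff_himp _ _ _).2 le_rfl
  suffices hw : rimp c 0 = 1 by
    have : c * 1 ≤ 0 := (mul_le_iff_rimp _ _ _).2 hw.ge
    rw [mul_one] at this
    exact (mul_le_iff_himp _ _ _).1 this
  by_contra hw
  have htriv : IsFilter {z : A | 1 ≤ z} :=
    ⟨⟨1, le_rfl⟩, fun x hx y hy => by
      have := mul2 (A := A) hx hy
      rwa [one_mul] at this, fun x hx y hxy => le_trans hx hxy⟩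
  have hF := isFilter_sup htriv (rimp c 0)
  obtain ⟨M, hM, hFM⟩ := exists_maximal hF (by
    intro h
    have h' : (1 : A) ≤ 0 ⊔ rimp c 0 := h
    rw [sup_eq_right.2 (zero_le _)] at h'
    exact hw (le_antisymm (le_one _) h'))
  have hN := hnorm M hM
  have split : ∀ u v : A, u * v = c → qle M (rimp u 0) v := by
    intro u v huv
    unfold qle
    rw [hN]
    apply hFM
    have : rimp (rimp u 0) v ⊔ rimp c 0 = 1 := by
      rw [← huv, rimp_mul, prelin_rimp]
    exact this.ge
  have hLa : qle M L.prod a := qle_perm hM hN hKL.symm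
  have hna' : lneg a ∈ M := by
    have h1 := split (lneg a) (lneg a * b) (by rw [hc, pow_two, mul_assoc])
    have h2 : qle M a (rimp (lneg a) 0) := qle_of_le hM ((mul_le_iff_rimp _ _ _).1 hna)
    have h3 : qle M (lneg a * b) 0 := by
      refine qle_trans hM (qle_mulL hM hN _
        (qle_trans hM (qle_of_le hM (prod_sq_le L)) hLa)) (qle_of_le hM hna)
    exact qle_trans hM (qle_trans hM h2 h1) h3
  have ha0 : qle M a 0 := hna'
  have step : ∀ q p : List A, p ++ q = L → (∀ z ∈ p, z ∈ M) → ∀ z ∈ L, z ∈ M := by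
    intro q
    induction q with
    | nil =>
      intro p hp h
      rw [List.append_nil] at hp
      rwa [← hp]
    | cons y q ih =>
      intro p hp h
      refine ih (p ++ [y]) (by simpa using hp) ?_
      have hy : y ∈ M := by
        apply mem_of_rneg hM hN
        have h1 := split (lneg a ^ 2 * (p.map (fun z => z ^ 2)).prod * y)
          (y * (q.map (fun z => z ^ 2)).prod) (by
            rw [hc, hb, ← hp]
            simp only [List.map_append, List.map_cons, List.prod_append, List.prod_cons,
              pow_two, mul_assoc])
        have h2 : qle M (rimp y 0)
            (rimp (lneg a ^ 2 * (p.map (fun z => z ^ 2)).prod * y) 0) := by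
          apply qle_of_le hM
          rw [← mul_le_iff_rimp]
          refine (mulR _ (mul_le_r _ y)).trans ?_
          rw [mul_le_iff_rimp]
        refine qle_trans hM (qle_trans hM h2 h1) (qle_trans hM ?_ (qle_trans hM hLa ha0))
        have h3 := qle_mulR hM (y * q.prod) (one_qle.2 (prod_mem hM.1 p h))
        rw [one_mul] at h3
        rw [← hp, List.prod_append, List.prod_cons]
        exact qle_trans hM (qle_of_le hM (mulL y (prod_sq_le q))) h3
      intro z hz
      rcases List.mem_append.1 hz with hz | hz
      · exact h z hz
      · rw [List.mem_singleton.1 hz]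
        exact hy
  have hall := step L [] rfl (by simp)
  exact not_one_qle_zero hM
    (qle_trans hM (one_qle.2 (prod_mem hM.1 L hall)) (qle_trans hM hLa ha0))

end quot

end PseudoBL

open PseudoBL

/-- In a nontrivial pseudo BL-algebra where every maximal filter is
normal, `((x₁⋯xₙ)⁻)² ≤ (x_{π(1)}²⋯x_{π(n)}²)⁻` for every permutation `π`. -/
theorem stmt_1 {A : Type*} [PseudoBL A] (hnt : (0 : A) ≠ 1)
    (hnorm : ∀ F : Set A, IsMaximalFilter F → IsNormalFilter F)
    (n : ℕ) (hn : 1 ≤ n) (x : Fin n → A) (π : Equiv.Perm (Fin n)) :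
    lneg (List.ofFn x).prod ^ 2 ≤ lneg (List.ofFn (fun i => x (π i) ^ 2)).prod := by
  have h := main_aux hnorm (List.ofFn x) (List.ofFn (x ∘ π)) (Equiv.Perm.ofFn_comp_perm π x).symm
  rw [List.map_ofFn] at h
  exact h
end

section
/- Let (A, u) be a unital basic pseudo hoop in which every maximal filter is normal. Then for every n ≥ 1, all x₁, …, xₙ ∈ A and every permutation π of {1, …, n}: ((x₁·⋯·xₙ)→u)² ≤ (x_{π(1)}²·⋯·x_{π(n)}²)→u. -/
/-- A pseudo hoop: a monoid `(A; ·, 1)` with two implications `→` (`himp`) and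
`⇝` (`rimp`) satisfying the pseudo-hoop identities, where the induced order
`x ≤ y ↔ x→y = 1 ↔ x⇝y = 1` is the given partial order. -/
class PseudoHoop (A : Type*) extends Monoid A, PartialOrder A where
  himp : A → A → A
  rimp : A → A → A
  himp_self : ∀ x : A, himp x x = 1
  rimp_self : ∀ x : A, rimp x x = 1
  himp_mul : ∀ x y z : A, himp (x * y) z = himp x (himp y z)
  rimp_mul : ∀ x y z : A, rimp (x * y) z = rimp y (rimp x z)
  div₁ : ∀ x y : A, himp x y * x = himp y x * y
  div₂ : ∀ x y : A, himp x y * x = x * rimp x y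
  div₃ : ∀ x y : A, x * rimp x y = y * rimp y x
  le_iff_himp : ∀ x y : A, x ≤ y ↔ himp x y = 1
  le_iff_rimp : ∀ x y : A, x ≤ y ↔ rimp x y = 1

/-- A basic pseudo hoop: a pseudo hoop satisfying (B1) and (B2). -/
class BasicPseudoHoop (A : Type*) extends PseudoHoop A where
  basic₁ : ∀ x y z : A,
    himp (himp x y) z ≤ himp (himp (himp y x) z) z
  basic₂ : ∀ x y z : A,
    rimp (rimp x y) z ≤ rimp (rimp (rimp y x) z) z

namespace PseudoHoop

variable {A : Type*} [PseudoHoop A]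

/-- A filter: a nonempty subset closed under `·` and upward closed. -/
def IsFilter (F : Set A) : Prop :=
  F.Nonempty ∧ (∀ x ∈ F, ∀ y ∈ F, x * y ∈ F) ∧ ∀ x ∈ F, ∀ y : A, x ≤ y → y ∈ F

/-- A maximal filter: a proper filter not properly contained in any proper filter. -/
def IsMaximalFilter (F : Set A) : Prop :=
  IsFilter F ∧ F ≠ Set.univ ∧
    ∀ G : Set A, IsFilter G → G ≠ Set.univ → F ⊆ G → F = G

/-- A normal filter: `x→y ∈ F` iff `x⇝y ∈ F`. -/
def IsNormalFilter (F : Set A) : Prop :=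
  ∀ x y : A, himp x y ∈ F ↔ rimp x y ∈ F

/-- The filter generated by an element `a`: all `x` with `aᵏ ≤ x` for some `k ≥ 1`. -/
def genFilter (a : A) : Set A := {x : A | ∃ k : ℕ, 1 ≤ k ∧ a ^ k ≤ x}

/-- A strong unit: an element generating the whole pseudo hoop as a filter. -/
def IsStrongUnit (u : A) : Prop := genFilter u = Set.univ

end PseudoHoop

open PseudoHoop

namespace PHAux

open PseudoHoop

section basics
variable {A : Type*} [PseudoHoop A]

lemma one_himp (z : A) : himp 1 z = z := by
  have h1 : ∀ x : A, himp x z = himp x (himp 1 z) := fun x => by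
    rw [← himp_mul, mul_one]
  apply le_antisymm
  · rw [le_iff_himp, h1, PseudoHoop.himp_self]
  · rw [le_iff_himp, ← h1, PseudoHoop.himp_self]

lemma le_one' (x : A) : x ≤ 1 := by
  have h : x = himp x 1 * x := by
    have := div₁ (1 : A) x
    rwa [one_himp, mul_one] at this
  rw [le_iff_himp]
  have h2 : himp x 1 = himp (himp x 1 * x) 1 := by rw [← h]
  rw [h2, himp_mul, PseudoHoop.himp_self]

lemma mul_le_iff (x y z : A) : x * y ≤ z ↔ x ≤ himp y z := by
  rw [le_iff_himp, le_iff_himp, himp_mul]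

lemma mul_le_iff' (x y z : A) : x * y ≤ z ↔ y ≤ rimp x z := by
  rw [le_iff_rimp, le_iff_rimp, rimp_mul]

lemma mul_mono_r {a b : A} (c : A) (h : a ≤ b) : a * c ≤ b * c :=
  (mul_le_iff _ _ _).2 (h.trans ((mul_le_iff _ _ _).1 le_rfl))

lemma mul_mono_l {a b : A} (c : A) (h : a ≤ b) : c * a ≤ c * b :=
  (mul_le_iff' _ _ _).2 (h.trans ((mul_le_iff' _ _ _).1 le_rfl))

lemma mul_le_right' (a b : A) : a * b ≤ b := by
  simpa using mul_mono_r b (le_one' a)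

lemma mul_le_left' (a b : A) : a * b ≤ a := by
  simpa using mul_mono_l a (le_one' b)

lemma himp_mul_le (a b : A) : himp a b * a ≤ b := (mul_le_iff _ _ _).2 le_rfl

lemma mul_rimp_le (a b : A) : a * rimp a b ≤ b := (mul_le_iff' _ _ _).2 le_rfl

lemma IsFilter.one_mem {F : Set A} (h : IsFilter F) : (1 : A) ∈ F := by
  obtain ⟨a, ha⟩ := h.1
  exact h.2.2 a ha 1 (le_one' a)

lemma exists_value (F : Set A) (hF : IsFilter F) (e : A) (he : e ∉ F) :
    ∃ V : Set A, F ⊆ V ∧ IsFilter V ∧ e ∉ V ∧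
      ∀ G : Set A, IsFilter G → e ∉ G → V ⊆ G → V = G := by
  obtain ⟨V, hFV, hV⟩ := zorn_subset_nonempty {G : Set A | IsFilter G ∧ e ∉ G} (by
    intro c hc hch hne
    refine ⟨⋃₀ c, ⟨⟨?_, ?_, ?_⟩, ?_⟩, fun s hs => Set.subset_sUnion_of_mem hs⟩
    · obtain ⟨s, hs⟩ := hne
      exact ⟨1, s, hs, IsFilter.one_mem (hc hs).1⟩
    · rintro x ⟨s, hs, hx⟩ y ⟨t, ht, hy⟩
      rcases hch.total hs ht with h | h
      · exact ⟨t, ht, (hc ht).1.2.1 x (h hx) y hy⟩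
      · exact ⟨s, hs, (hc hs).1.2.1 x hx y (h hy)⟩
    · rintro x ⟨s, hs, hx⟩ y hxy
      exact ⟨s, hs, (hc hs).1.2.2 x hx y hxy⟩
    · rintro ⟨s, hs, hx⟩
      exact (hc hs).2 hx) F ⟨hF, he⟩
  refine ⟨V, hFV, hV.prop.1, hV.prop.2, fun G hG heG hVG => ?_⟩
  exact hV.eq_of_subset ⟨hG, heG⟩ hVG

/-- relative polar of `q` over the filter `V` -/
lemma polar_filter {V : Set A} (hV : IsFilter V) (q : A) :
    IsFilter {z : A | ∀ t, z ≤ t → q ≤ t → t ∈ V} := by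
  refine ⟨⟨1, fun t h _ => hV.2.2 1 (IsFilter.one_mem hV) t h⟩, ?_, ?_⟩
  · intro z hz z' hz' t h1 h2
    have hv : rimp z t ∈ V := hz' _ ((mul_le_iff' _ _ _).1 h1)
      ((mul_le_iff' _ _ _).1 ((mul_le_right' _ _).trans h2))
    have hw : himp (rimp z t) t ∈ V := hz _ ((mul_le_iff _ _ _).1 (mul_rimp_le _ _))
      ((mul_le_iff _ _ _).1 ((mul_le_left' _ _).trans h2))
    exact hV.2.2 _ (hV.2.1 _ hw _ hv) _ (himp_mul_le _ _)
  · intro z hz y hzy t h1 h2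
    exact hz t (hzy.trans h1) h2

end basics

lemma value_total {A : Type*} [BasicPseudoHoop A] {V : Set A} (hV : IsFilter V) (e : A)
    (he : e ∉ V) (hmax : ∀ G : Set A, IsFilter G → e ∉ G → V ⊆ G → V = G) (x y : A) :
    himp x y ∈ V ∨ himp y x ∈ V := by
  by_contra hcon
  push Not at hcon
  obtain ⟨hp, hq⟩ := hcon
  have key : ∀ t : A, himp x y ≤ t → himp y x ≤ t → t ∈ V := by
    intro t h1 h2
    have hb := BasicPseudoHoop.basic₁ x y t
    rw [(le_iff_himp _ _).1 h1, (le_iff_himp _ _).1 h2, one_himp] at hb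
    exact hV.2.2 1 (IsFilter.one_mem hV) t hb
  have h1 : e ∈ {z : A | ∀ t, z ≤ t → himp y x ≤ t → t ∈ V} := by
    by_contra hne
    have := hmax _ (polar_filter hV (himp y x)) hne
      (fun v hv t h _ => hV.2.2 v hv t h)
    apply hp
    rw [this]
    exact key
  have h2 : e ∈ {z : A | ∀ t, z ≤ t → e ≤ t → t ∈ V} := by
    by_contra hne
    have := hmax _ (polar_filter hV e) hne
      (fun v hv t h _ => hV.2.2 v hv t h)
    apply hq
    rw [this]
    exact fun t ht het => h1 t het ht
  exact he (h2 e le_rfl le_rfl)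

/-- Hölder-type argument: commutativity of an Archimedean linear divisible residuated preorder. -/
lemma holder {A : Type*} [Monoid A] (r : A → A → Prop) (im : A → A → A)
    (rfl' : ∀ a, r a a) (tr : ∀ a b c, r a b → r b c → r a c)
    (tot : ∀ a b, r a b ∨ r b a)
    (mul : ∀ a b c d, r a b → r c d → r (a * c) (b * d))
    (top : ∀ a, r a 1)
    (res : ∀ a b c, r (a * b) c ↔ r a (im b c))
    (dvd : ∀ a b, r a b → r a (im b a * b))
    (arch : ∀ a b, ¬ r 1 a → ∃ k : ℕ, r (a ^ k) b) (x y : A) : r (x * y) (y * x) := by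
  have level : ∀ e z : A, (¬ ∃ m : ℕ, r z (e ^ m) ∧ ¬ r z (e ^ (m + 1))) → ∀ m : ℕ, r z (e ^ m) := by
    intro e z h m
    induction m with
    | zero => simpa using top z
    | succ k ih =>
      by_contra hk
      exact h ⟨k, ih, hk⟩
  have bot : ∀ e z : A, ¬ r 1 e → (∀ m : ℕ, r z (e ^ m)) → ∀ b, r z b := by
    intro e z he h b
    obtain ⟨k, hk⟩ := arch e b he
    exact tr _ _ _ (h k) hk
  have lef : ∀ a b, r (a * b) a := fun a b => by simpa using mul a a b 1 (rfl' a) (top b)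
  have rig : ∀ a b, r (a * b) b := fun a b => by simpa using mul a 1 b b (top a) (rfl' b)
  have gen : ∀ e, ¬ r 1 e → (∀ m k : ℕ, r x (e ^ m) → ¬ r x (e ^ (m + 1)) →
      r y (e ^ k) → ¬ r y (e ^ (k + 1)) → r (x * y) (y * x)) → r (x * y) (y * x) := by
    intro e he H
    by_cases hx : ∃ m : ℕ, r x (e ^ m) ∧ ¬ r x (e ^ (m + 1))
    · by_cases hy : ∃ m : ℕ, r y (e ^ m) ∧ ¬ r y (e ^ (m + 1))
      · obtain ⟨m, h1, h2⟩ := hx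
        obtain ⟨k, h3, h4⟩ := hy
        exact H m k h1 h2 h3 h4
      · exact tr _ _ _ (rig x y) (bot e y he (level e y hy) _)
    · exact tr _ _ _ (lef x y) (bot e x he (level e x hx) _)
  by_cases gap : ∃ e, ¬ r 1 e ∧ ∀ g, ¬ r 1 g → r g e
  · obtain ⟨e, he, hg⟩ := gap
    have up : ∀ z (m : ℕ), r z (e ^ m) → ¬ r z (e ^ (m + 1)) → r (e ^ m) z := by
      intro z m h1 h2
      by_contra hc
      apply h2
      have hn : ¬ r 1 (im (e ^ m) z) := fun h => hc (by simpa using (res 1 (e ^ m) z).2 h)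
      rw [pow_succ']
      exact tr _ _ _ (dvd _ _ h1) (mul _ _ _ _ (hg _ hn) (rfl' _))
    apply gen e he
    intro m k h1 h2 h3 h4
    refine tr _ _ _ (mul _ _ _ _ h1 h3) ?_
    rw [← pow_add, add_comm, pow_add]
    exact mul _ _ _ _ (up y k h3 h4) (up x m h1 h2)
  · push Not at gap
    by_contra hcon
    have hd : ¬ r 1 (im (x * y) (y * x)) := fun h => hcon (by simpa using (res 1 _ _).2 h)
    obtain ⟨e, he, hed⟩ := gap _ hd
    obtain ⟨g, hg, hge⟩ := gap e he
    have hf : ∃ f, ¬ r 1 f ∧ r e (f * f) := by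
      have heg : r e g := (tot e g).resolve_right hge
      have h1 : ¬ r 1 (im g e) := fun h => hge (by simpa using (res 1 _ _).2 h)
      rcases tot g (im g e) with h | h
      · exact ⟨_, h1, tr _ _ _ (dvd _ _ heg) (mul _ _ _ _ (rfl' _) h)⟩
      · exact ⟨g, hg, tr _ _ _ (dvd _ _ heg) (mul _ _ _ _ h (rfl' _))⟩
    obtain ⟨f, hf1, hf2⟩ := hf
    apply hcon
    apply gen f hf1
    intro m k h1 h2 h3 h4
    exfalso
    apply hed
    refine tr _ _ _ hf2 ?_
    rw [← res]
    refine tr _ _ _ (mul _ _ _ _ (rfl' _) (mul _ _ _ _ h1 h3)) ?_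
    have e1 : f * f * (f ^ m * f ^ k) = f ^ (k + 1) * f ^ (m + 1) := by
      rw [← pow_add, ← pow_add, ← pow_two, ← pow_add]
      congr 1
      omega
    rw [e1]
    exact mul _ _ _ _ ((tot _ _).resolve_left h4) ((tot _ _).resolve_left h2)

lemma sq_prod_le {A : Type*} [PseudoHoop A] (l : List A) :
    (l.map (fun a => a ^ 2)).prod ≤ l.prod := by
  induction l with
  | nil => simp
  | cons a l ih =>
    simp only [List.map_cons, List.prod_cons]
    refine (mul_mono_l _ ih).trans (mul_mono_r _ ?_)
    rw [pow_two]
    exact mul_le_left' a a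

end PHAux

open PHAux in
theorem stmt_15 {A : Type*} [BasicPseudoHoop A] (u : A) (hu : IsStrongUnit u)
    (hnorm : ∀ F : Set A, IsMaximalFilter F → IsNormalFilter F)
    (n : ℕ) (hn : 1 ≤ n) (x : Fin n → A) (π : Equiv.Perm (Fin n)) :
    PseudoHoop.himp (List.ofFn x).prod u ^ 2 ≤
      PseudoHoop.himp (List.ofFn (fun i => x (π i) ^ 2)).prod u := by
  set P := (List.ofFn x).prod with hP
  set c := PseudoHoop.himp P u with hc
  set l := List.ofFn (fun i => x (π i)) with hl
  have hQ : List.ofFn (fun i => x (π i) ^ 2) = l.map (fun a => a ^ 2) := by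
    rw [hl, List.map_ofFn]; rfl
  rw [hQ]
  set Q := (l.map (fun a => a ^ 2)).prod with hQd
  have hperm : l.Perm (List.ofFn x) := Equiv.Perm.ofFn_comp_perm π x
  by_contra hcon
  rw [le_iff_himp, ← himp_mul] at hcon
  -- the value `V`
  have hF1 : IsFilter ({1} : Set A) := by
    refine ⟨⟨1, rfl⟩, ?_, ?_⟩
    · rintro a rfl b rfl
      simp
    · rintro a rfl b hb
      exact le_antisymm (le_one' b) hb
  obtain ⟨V, -, hV, heV, hVmax⟩ := exists_value {1} hF1 _ hcon
  have hVtot := value_total hV _ heV hVmax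
  have hpow : ∀ G : Set A, IsFilter G → u ∈ G → G = Set.univ := by
    intro G hG huG
    have hk : ∀ k : ℕ, u ^ k ∈ G := by
      intro k
      induction k with
      | zero => simpa using IsFilter.one_mem hG
      | succ k ih => rw [pow_succ]; exact hG.2.1 _ ih _ huG
    ext z
    simp only [Set.mem_univ, iff_true]
    have hz : z ∈ genFilter u := by rw [hu]; trivial
    obtain ⟨k, -, hkz⟩ := hz
    exact hG.2.2 _ (hk k) _ hkz
  have huV : u ∉ V := fun h => heV (by rw [hpow V hV h]; trivial)
  obtain ⟨M, hVM, hM, huM, hMmax⟩ := exists_value V hV u huV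
  have hMx : IsMaximalFilter M := by
    refine ⟨hM, fun h => huM (by rw [h]; trivial), fun G hG hGu hMG => ?_⟩
    exact hMmax G hG (fun h => hGu (hpow G hG h)) hMG
  have hN := hnorm M hMx
  have one_mem : (1 : A) ∈ M := IsFilter.one_mem hM
  -- preorder modulo `M`
  let r : A → A → Prop := fun a b => himp a b ∈ M
  have rle : ∀ a b : A, a ≤ b → r a b := fun a b h => by
    change himp a b ∈ M
    rw [(le_iff_himp _ _).1 h]; exact one_mem
  have rtr : ∀ a b d : A, r a b → r b d → r a d := by
    intro a b d h1 h2
    refine hM.2.2 _ (hM.2.1 _ h2 _ h1) _ ?_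
    rw [← mul_le_iff, mul_assoc]
    exact (mul_mono_l _ (himp_mul_le a b)).trans (himp_mul_le b d)
  have rtot : ∀ a b : A, r a b ∨ r b a := fun a b =>
    (hVtot a b).imp (fun h => hVM h) (fun h => hVM h)
  have rmr : ∀ a b d : A, r a b → r (a * d) (b * d) := by
    intro a b d h
    refine hM.2.2 _ h _ ?_
    rw [← mul_le_iff, ← mul_assoc]
    exact mul_mono_r _ (himp_mul_le a b)
  have rml : ∀ a b d : A, r a b → r (d * a) (d * b) := by
    intro a b d h
    refine (hN _ _).2 (hM.2.2 _ ((hN _ _).1 h) _ ?_)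
    rw [← mul_le_iff', mul_assoc]
    exact mul_mono_l _ (mul_rimp_le a b)
  have rmul : ∀ a b d e : A, r a b → r d e → r (a * d) (b * e) := fun a b d e h1 h2 =>
    rtr _ _ _ (rmr a b d h1) (rml d e b h2)
  have rone : ∀ a : A, r 1 a ↔ a ∈ M := fun a => by
    change himp 1 a ∈ M ↔ _
    rw [one_himp]
  have rres : ∀ a b d : A, r (a * b) d ↔ r a (himp b d) := fun a b d => by
    change himp (a * b) d ∈ M ↔ himp a (himp b d) ∈ M
    rw [himp_mul]
  have rdvd : ∀ a b : A, r a b → r a (himp b a * b) := by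
    intro a b h
    rw [div₁ b a]
    have := rmr _ _ a ((rone _).2 h)
    simpa using this
  have rarch : ∀ a b : A, ¬ r 1 a → ∃ k : ℕ, r (a ^ k) b := by
    intro a b ha
    have hG : IsFilter {z : A | ∃ k : ℕ, r (a ^ k) z} := by
      refine ⟨⟨1, 0, by simpa using rle 1 1 le_rfl⟩, ?_, ?_⟩
      · rintro z ⟨k, hk⟩ z' ⟨k', hk'⟩
        exact ⟨k + k', by rw [pow_add]; exact rmul _ _ _ _ hk hk'⟩
      · rintro z ⟨k, hk⟩ z' hzz
        exact ⟨k, rtr _ _ _ hk (rle _ _ hzz)⟩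
    by_contra hb
    have hne : {z : A | ∃ k : ℕ, r (a ^ k) z} ≠ Set.univ := by
      intro h
      apply hb
      have : b ∈ {z : A | ∃ k : ℕ, r (a ^ k) z} := by rw [h]; trivial
      exact this
    have := hMx.2.2 _ hG hne (fun m hm => ⟨0, by simpa using (rone m).2 hm⟩)
    apply ha
    rw [rone, this]
    exact ⟨1, by simpa using rle a a le_rfl⟩
  have rcomm : ∀ a b : A, r (a * b) (b * a) :=
    holder r himp (fun a => rle a a le_rfl) rtr rtot rmul (fun a => rle a 1 (le_one' a)) rres
      rdvd rarch
  have rperm : ∀ l₁ l₂ : List A, l₁.Perm l₂ → r l₁.prod l₂.prod := by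
    intro l₁ l₂ h
    induction h with
    | nil => exact rle _ _ le_rfl
    | cons a _ ih => simpa using rml _ _ a ih
    | swap a b l =>
      simp only [List.prod_cons, ← mul_assoc]
      exact rmr _ _ _ (rcomm b a)
    | trans _ _ h1 h2 => exact rtr _ _ _ h1 h2
  -- splitting
  have split : ∀ a b : A, c ^ 2 * Q = a * b → a ∉ M → r b u → False := by
    intro a b hab ha hb
    rw [hab, himp_mul] at heV
    have h := (hVtot a (himp b u)).resolve_left heV
    exact ha ((rone a).1 (rtr _ _ _ ((rone _).2 hb) (hVM h)))
  have hlP : r l.prod P := rperm _ _ hperm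
  have hQP : r Q P := rtr _ _ _ (rle _ _ (sq_prod_le l)) hlP
  by_cases hcM : c ∈ M
  · have hlu : r l.prod u := rtr _ _ _ hlP hcM
    have main : ∀ l : List A, r l.prod u →
        ∃ a b : A, (l.map (fun a => a ^ 2)).prod = a * b ∧ a ∉ M ∧ r b u := by
      intro l
      induction l with
      | nil =>
        intro h
        exact absurd ((rone u).1 (by simpa using h)) huM
      | cons y l ih =>
        intro h
        rw [List.prod_cons] at h
        by_cases hy : y ∈ M
        · have h' : r l.prod u := by
            refine rtr _ _ _ ?_ h
            simpa using rmr _ _ l.prod ((rone y).2 hy)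
          obtain ⟨a, b, h1, h2, h3⟩ := ih h'
          refine ⟨y ^ 2 * a, b, ?_, ?_, h3⟩
          · rw [List.map_cons, List.prod_cons, h1, mul_assoc]
          · exact fun h4 => h2 (hM.2.2 _ h4 _ (mul_le_right' _ _))
        · refine ⟨y, y * (l.map (fun a => a ^ 2)).prod, ?_, hy, ?_⟩
          · rw [List.map_cons, List.prod_cons, pow_two, mul_assoc]
          · exact rtr _ _ _ (rle _ _ (mul_mono_l _ (sq_prod_le l))) h
    obtain ⟨a, b, h1, h2, h3⟩ := main l hlu
    refine split (c ^ 2 * a) b ?_ ?_ h3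
    · rw [hQd, h1, mul_assoc]
    · exact fun h4 => h2 (hM.2.2 _ h4 _ (mul_le_right' _ _))
  · refine split c (c * Q) (by rw [pow_two, mul_assoc]) hcM ?_
    exact rtr _ _ _ (rml _ _ c hQP) (rle _ _ (himp_mul_le P u))
end

section
/- Let (A, u) be a unital basic pseudo hoop in which every maximal filter is normal. Then for every n ≥ 1 and all x, y ∈ A: (((x→y)ⁿ)→u)² ≤ ((x⇝y)^{2n})→u and (((x⇝y)ⁿ)→u)² ≤ ((x→y)^{2n})→u. -/
namespace PseudoHoop

section Basic
variable {A : Type*} [PseudoHoop A]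

theorem le_himp_iff (x y z : A) : z ≤ himp x y ↔ z * x ≤ y := by
  rw [le_iff_himp, le_iff_himp (z * x), himp_mul]

theorem le_rimp_iff (x y z : A) : z ≤ rimp x y ↔ x * z ≤ y := by
  rw [le_iff_rimp, le_iff_rimp (x * z), rimp_mul]

theorem one_himp' (x : A) : himp 1 x = x := by
  apply le_antisymm
  · have := (le_himp_iff 1 x (himp 1 x)).1 le_rfl
    simpa using this
  · rw [le_himp_iff]; simp

theorem le_one' (x : A) : x ≤ 1 := by
  rw [le_iff_himp]
  have h : himp x 1 * x = x := by
    rw [div₁, one_himp', mul_one]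
  have h2 : himp x 1 = himp (himp x 1 * x) 1 := by rw [h]
  rw [h2, himp_mul, himp_self]

theorem mul_mono_right' {x y : A} (h : x ≤ y) (z : A) : x * z ≤ y * z := by
  rw [← le_himp_iff]
  exact h.trans ((le_himp_iff _ _ _).2 le_rfl)

theorem mul_mono_left' {x y : A} (h : x ≤ y) (z : A) : z * x ≤ z * y := by
  rw [← le_rimp_iff]
  exact h.trans ((le_rimp_iff _ _ _).2 le_rfl)

theorem mul_le_r (x y : A) : x * y ≤ y := by
  simpa using mul_mono_right' (le_one' x) y

theorem mul_le_l (x y : A) : x * y ≤ x := by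
  simpa using mul_mono_left' (le_one' y) x

theorem himp_mul_le (x y : A) : himp x y * x ≤ y := (le_himp_iff _ _ _).1 le_rfl

theorem mul_rimp_le (x y : A) : x * rimp x y ≤ y := (le_rimp_iff _ _ _).1 le_rfl

theorem IsFilter.one_mem {F : Set A} (h : IsFilter F) : (1 : A) ∈ F := by
  obtain ⟨⟨a, ha⟩, _, h3⟩ := h
  exact h3 a ha 1 (le_one' a)

theorem IsFilter.mp {F : Set A} (h : IsFilter F) {x y : A} (hx : x ∈ F) (hxy : himp x y ∈ F) :
    y ∈ F :=
  h.2.2 _ (h.2.1 _ hxy _ hx) _ (himp_mul_le x y)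

theorem IsFilter.eq_univ {F : Set A} (h : IsFilter F) {u : A} (hu : IsStrongUnit u)
    (huF : u ∈ F) : F = Set.univ := by
  apply Set.eq_univ_of_forall
  intro x
  have hx : x ∈ genFilter u := by rw [hu]; trivial
  obtain ⟨k, _, hk⟩ := hx
  refine h.2.2 _ ?_ _ hk
  clear hk
  induction k with
  | zero => simpa using h.one_mem
  | succ k ih =>
    rcases Nat.eq_zero_or_pos k with rfl | h0
    · simpa using huF
    · rw [pow_succ]; exact h.2.1 _ (ih h0) _ huF

theorem singleton_filter : IsFilter ({1} : Set A) := by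
  refine ⟨⟨1, rfl⟩, ?_, ?_⟩
  · rintro x rfl y rfl; simp
  · rintro x rfl y h
    exact le_antisymm (le_one' y) h

/-- Zorn: extend a filter to one maximal among those avoiding `t`. -/
theorem exists_value {F : Set A} (hF : IsFilter F) {t : A} (ht : t ∉ F) :
    ∃ P : Set A, F ⊆ P ∧ IsFilter P ∧ t ∉ P ∧
      ∀ G : Set A, IsFilter G → P ⊆ G → t ∉ G → P = G := by
  obtain ⟨P, hFP, hP⟩ := zorn_subset_nonempty {G : Set A | IsFilter G ∧ t ∉ G} (by
    intro c hc hchain hne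
    refine ⟨⋃₀ c, ⟨⟨?_, ?_, ?_⟩, ?_⟩, fun s hs => Set.subset_sUnion_of_mem hs⟩
    · obtain ⟨s, hs⟩ := hne
      exact ⟨1, s, hs, (hc hs).1.one_mem⟩
    · rintro x ⟨s, hs, hx⟩ y ⟨s', hs', hy⟩
      rcases hchain.total hs hs' with h | h
      · exact ⟨s', hs', (hc hs').1.2.1 _ (h hx) _ hy⟩
      · exact ⟨s, hs, (hc hs).1.2.1 _ hx _ (h hy)⟩
    · rintro x ⟨s, hs, hx⟩ y hxy
      exact ⟨s, hs, (hc hs).1.2.2 _ hx _ hxy⟩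
    · rintro ⟨s, hs, hx⟩
      exact (hc hs).2 hx) F ⟨hF, ht⟩
  refine ⟨P, hFP, hP.prop.1, hP.prop.2, ?_⟩
  intro G hG hPG htG
  exact Set.Subset.antisymm hPG (hP.le_of_ge ⟨hG, htG⟩ hPG)

/-- The relative polar of an element is a filter. -/
theorem polar_filter {P : Set A} (hP : IsFilter P) (h : A) :
    IsFilter {x : A | ∀ z, x ≤ z → h ≤ z → z ∈ P} := by
  refine ⟨⟨1, ?_⟩, ?_, ?_⟩
  · intro z hz _
    exact hP.2.2 _ hP.one_mem _ hz
  · intro x hx y hy z hz hhz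
    have h1 : rimp x z ∈ P := by
      apply hy
      · rwa [le_rimp_iff]
      · refine hhz.trans ?_
        rw [le_rimp_iff]; exact mul_le_r _ _
    have h2 : himp (rimp x z) z ∈ P := by
      apply hx
      · rw [le_himp_iff]; exact mul_rimp_le _ _
      · refine hhz.trans ?_
        rw [le_himp_iff]; exact mul_le_l _ _
    exact hP.mp h1 h2
  · intro x hx y hxy z hz hhz
    exact hx z (hxy.trans hz) hhz

end Basic

theorem value_prime {A : Type*} [BasicPseudoHoop A] {P : Set A} (hP : IsFilter P) {t : A}
    (ht : t ∉ P) (hmax : ∀ G : Set A, IsFilter G → P ⊆ G → t ∉ G → P = G) (d s : A) :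
    himp d s ∈ P ∨ himp s d ∈ P := by
  by_contra hcon
  push Not at hcon
  obtain ⟨hg, hh⟩ := hcon
  have horth : ∀ z, himp d s ≤ z → himp s d ≤ z → z ∈ P := by
    intro z h1 h2
    have := BasicPseudoHoop.basic₁ d s z
    rw [(le_iff_himp _ _).1 h1, (le_iff_himp _ _).1 h2, one_himp'] at this
    exact hP.2.2 _ hP.one_mem _ this
  have h1 : ∀ z, t ≤ z → himp s d ≤ z → z ∈ P := by
    by_contra hc
    have heq := hmax _ (polar_filter hP (himp s d))
      (fun x hx z hz _ => hP.2.2 _ hx _ hz) hc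
    exact hg (heq ▸ (show himp d s ∈ {x : A | ∀ z, x ≤ z → himp s d ≤ z → z ∈ P} from horth))
  have h2 : ∀ z, t ≤ z → t ≤ z → z ∈ P := by
    by_contra hc
    have heq := hmax _ (polar_filter hP t)
      (fun x hx z hz _ => hP.2.2 _ hx _ hz) hc
    exact hh (heq ▸ (show himp s d ∈ {x : A | ∀ z, x ≤ z → t ≤ z → z ∈ P} from
      fun z a b => h1 z b a))
  exact ht (h2 t le_rfl le_rfl)

section Quot
variable {A : Type*} [PseudoHoop A] {M : Set A}

theorem L_of_le (hM : IsFilter M) {x y : A} (h : x ≤ y) : himp x y ∈ M := by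
  rw [(le_iff_himp _ _).1 h]; exact hM.one_mem

theorem L_trans (hM : IsFilter M) {x y z : A} (h1 : himp x y ∈ M) (h2 : himp y z ∈ M) :
    himp x z ∈ M := by
  refine hM.2.2 _ (hM.2.1 _ h2 _ h1) _ ?_
  rw [le_himp_iff, mul_assoc]
  exact (mul_mono_left' (himp_mul_le x y) _).trans (himp_mul_le y z)

theorem L_mul_right (hM : IsFilter M) {x y : A} (h : himp x y ∈ M) (z : A) :
    himp (x * z) (y * z) ∈ M := by
  refine hM.2.2 _ h _ ?_
  rw [le_himp_iff, ← mul_assoc]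
  exact mul_mono_right' (himp_mul_le x y) z

theorem L_mul_left (hM : IsFilter M) (hN : IsNormalFilter M) {x y : A} (h : himp x y ∈ M)
    (z : A) : himp (z * x) (z * y) ∈ M := by
  rw [hN] at h ⊢
  refine hM.2.2 _ h _ ?_
  rw [le_rimp_iff, mul_assoc]
  exact mul_mono_left' (mul_rimp_le x y) z

theorem L_mul (hM : IsFilter M) (hN : IsNormalFilter M) {x y x' y' : A} (h : himp x y ∈ M)
    (h' : himp x' y' ∈ M) : himp (x * x') (y * y') ∈ M :=
  L_trans hM (L_mul_right hM h x') (L_mul_left hM hN h' y)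

theorem L_pow (hM : IsFilter M) (hN : IsNormalFilter M) {x y : A} (h : himp x y ∈ M) (n : ℕ) :
    himp (x ^ n) (y ^ n) ∈ M := by
  induction n with
  | zero => simpa using L_of_le hM (le_refl (1 : A))
  | succ n ih => rw [pow_succ, pow_succ]; exact L_mul hM hN ih h

theorem L_unit_mul (hM : IsFilter M) {m : A} (hm : m ∈ M) (x : A) : himp x (m * x) ∈ M :=
  hM.2.2 _ hm _ ((le_himp_iff _ _ _).2 le_rfl)

theorem L_div (hM : IsFilter M) {x y : A} (h : himp x y ∈ M) : himp x (himp y x * y) ∈ M := by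
  rw [← div₁]; exact L_unit_mul hM h x

theorem arch (hM : IsMaximalFilter M) (hN : IsNormalFilter M) {t : A} (ht : t ∉ M) (x : A) :
    ∃ k : ℕ, himp (t ^ k) x ∈ M := by
  have hF := hM.1
  by_contra hc
  have hG : IsFilter {x : A | ∃ k : ℕ, himp (t ^ k) x ∈ M} := by
    refine ⟨⟨1, 0, L_of_le hF (le_one' _)⟩, ?_, ?_⟩
    · rintro a ⟨k, hk⟩ b ⟨l, hl⟩
      exact ⟨k + l, by rw [pow_add]; exact L_mul hF hN hk hl⟩
    · rintro a ⟨k, hk⟩ b hab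
      exact ⟨k, L_trans hF hk (L_of_le hF hab)⟩
  have heq := hM.2.2 _ hG (fun h => hc (by
    have : x ∈ {x : A | ∃ k : ℕ, himp (t ^ k) x ∈ M} := by rw [h]; trivial
    exact this)) (fun a ha => ⟨0, by rw [pow_zero, one_himp']; exact ha⟩)
  apply ht
  rw [heq]
  exact ⟨1, by rw [pow_one]; exact L_of_le hF le_rfl⟩

theorem arch_sandwich (hM : IsMaximalFilter M) (hN : IsNormalFilter M)
    (htot : ∀ x y : A, himp x y ∈ M ∨ himp y x ∈ M) {t : A} (ht : t ∉ M) (x : A) :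
    ∃ k : ℕ, himp (t ^ (k + 1)) x ∈ M ∧ himp x (t ^ k) ∈ M := by
  classical
  have hF := hM.1
  have hex := arch hM hN ht x
  have h1 := Nat.find_spec hex
  have h2 := fun m => @Nat.find_min _ _ hex m
  generalize Nat.find hex = k at h1 h2
  cases k with
  | zero =>
    refine ⟨0, L_trans hF (L_of_le hF ?_) h1, L_of_le hF ?_⟩
    · rw [pow_zero]; exact le_one' _
    · rw [pow_zero]; exact le_one' _
  | succ j => exact ⟨j, h1, (htot _ _).resolve_left (h2 j (Nat.lt_succ_self j))⟩

theorem coatom_pow (hM : IsMaximalFilter M) (hN : IsNormalFilter M)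
    (htot : ∀ x y : A, himp x y ∈ M ∨ himp y x ∈ M) {e : A} (he : e ∉ M)
    (hco : ∀ r, r ∉ M → himp r e ∈ M) (x : A) :
    ∃ k : ℕ, himp (e ^ k) x ∈ M ∧ himp x (e ^ k) ∈ M := by
  classical
  have hF := hM.1
  have hex := arch hM hN he x
  have h1 := Nat.find_spec hex
  have h2 := fun m => @Nat.find_min _ _ hex m
  generalize Nat.find hex = k at h1 h2
  cases k with
  | zero => exact ⟨0, h1, L_of_le hF (by rw [pow_zero]; exact le_one' _)⟩
  | succ j =>
    have h3 := h2 j (Nat.lt_succ_self j)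
    refine ⟨j + 1, h1, ?_⟩
    have h4 := (htot _ _).resolve_left h3
    refine L_trans hF (L_div hF h4) ?_
    rw [pow_succ']
    exact L_mul_right hF (hco _ h3) _

/-- Hölder-type theorem: modulo a maximal normal filter, multiplication commutes. -/
theorem comm_mod (hM : IsMaximalFilter M) (hN : IsNormalFilter M)
    (htot : ∀ x y : A, himp x y ∈ M ∨ himp y x ∈ M) (x y : A) :
    himp (y * x) (x * y) ∈ M := by
  have hF := hM.1
  by_cases hco : ∃ e, e ∉ M ∧ ∀ r, r ∉ M → himp r e ∈ M
  · obtain ⟨e, he, hco⟩ := hco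
    obtain ⟨k, hk1, hk2⟩ := coatom_pow hM hN htot he hco x
    obtain ⟨l, hl1, hl2⟩ := coatom_pow hM hN htot he hco y
    have h1 := L_mul hF hN hl2 hk2
    have h2 := L_mul hF hN hk1 hl1
    rw [← pow_add] at h1 h2
    rw [add_comm] at h1
    exact L_trans hF h1 h2
  · push Not at hco
    by_contra hz
    obtain ⟨z', hz', hzz⟩ := hco _ hz
    obtain ⟨s, hs, hsz⟩ := hco _ hz'
    have hzs := (htot _ _).resolve_left hsz
    have hrs := L_div hF hzs
    obtain ⟨t, ht, htt⟩ : ∃ t, t ∉ M ∧ himp z' (t * t) ∈ M := by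
      rcases htot (himp s z') s with h | h
      · exact ⟨s, hs, L_trans hF hrs (L_mul_right hF h _)⟩
      · exact ⟨himp s z', hsz, L_trans hF hrs (L_mul_left hF hN h _)⟩
    obtain ⟨k, hk1, hk2⟩ := arch_sandwich hM hN htot ht x
    obtain ⟨l, hl1, hl2⟩ := arch_sandwich hM hN htot ht y
    have h1 := L_mul_left hF hN (L_mul hF hN hl2 hk2) (t * t)
    have h2 := L_mul hF hN hk1 hl1
    have heq : t * t * (t ^ l * t ^ k) = t ^ (k + 1) * t ^ (l + 1) := by
      rw [← pow_add, ← pow_add, ← pow_two, ← pow_add]; congr 1; omega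
    rw [heq] at h1
    have h3 := L_trans hF h1 h2
    rw [himp_mul (t * t)] at h3
    exact hzz (L_trans hF htt h3)

theorem himp_rimp_mod (hM : IsMaximalFilter M) (hN : IsNormalFilter M)
    (htot : ∀ x y : A, himp x y ∈ M ∨ himp y x ∈ M) (x y : A) :
    himp (himp x y) (rimp x y) ∈ M ∧ himp (rimp x y) (himp x y) ∈ M := by
  have hF := hM.1
  constructor
  · rw [hN, ← rimp_mul, ← hN]
    exact L_trans hF (comm_mod hM hN htot _ _) (L_of_le hF (himp_mul_le x y))
  · rw [← himp_mul]
    exact L_trans hF (comm_mod hM hN htot _ _) (L_of_le hF (mul_rimp_le x y))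

end Quot

theorem main_ineq {A : Type*} [BasicPseudoHoop A] (u : A) (hu : IsStrongUnit u)
    (hnorm : ∀ F : Set A, IsMaximalFilter F → IsNormalFilter F) (a b : A)
    (hab : ∀ M : Set A, IsMaximalFilter M → (∀ x y : A, himp x y ∈ M ∨ himp y x ∈ M) →
      himp a b ∈ M ∧ himp b a ∈ M) :
    himp a u ^ 2 ≤ himp (b * b) u := by
  rw [le_himp_iff]
  by_contra hne
  have ht : himp (himp a u ^ 2 * (b * b)) u ∉ ({1} : Set A) := by
    intro h
    exact hne ((le_iff_himp _ _).2 h)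
  obtain ⟨P, -, hP, htP, hPmax⟩ := exists_value singleton_filter ht
  have hPtot := value_prime hP htP hPmax
  have huP : u ∉ P := fun h => by
    rw [hP.eq_univ hu h] at htP; exact htP trivial
  obtain ⟨M, hPM, hF, huM, hMmax⟩ := exists_value hP huP
  have hM : IsMaximalFilter M := by
    refine ⟨hF, fun h => huM (by rw [h]; trivial), ?_⟩
    intro G hG hGu hMG
    exact hMmax G hG hMG (fun h => hGu (hG.eq_univ hu h))
  have hN := hnorm M hM
  have htot := value_prime hF huM hMmax
  obtain ⟨h1, h2⟩ := hab M hM htot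
  have key : ∀ d e : A, d * e = himp a u ^ 2 * (b * b) → d ∉ M → himp e u ∈ M → False := by
    intro d e hde hd he
    rcases hPtot d (himp e u) with h | h
    · rw [← himp_mul, hde] at h; exact htP h
    · exact hd (hF.mp he (hPM h))
  by_cases hc : himp a u ∈ M
  · have hbu := L_trans hF h2 hc
    refine key (himp a u ^ 2 * b) b (by rw [mul_assoc]) ?_ hbu
    intro h
    exact huM (hF.mp (hF.2.2 _ h _ (mul_le_r _ _)) hbu)
  · refine key (himp a u) (himp a u * (b * b)) (by rw [pow_two, mul_assoc]) hc ?_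
    have h3 := L_mul_right hF (L_mul_left hF hN h2 (himp a u)) b
    rw [← mul_assoc]
    refine L_trans hF h3 (L_of_le hF ?_)
    exact (mul_le_l _ _).trans (himp_mul_le _ _)

end PseudoHoop

open PseudoHoop

/-- In a unital basic pseudo hoop `(A, u)` whose every maximal filter
is normal, `(((x→y)ⁿ)→u)² ≤ ((x⇝y)^{2n})→u` and `(((x⇝y)ⁿ)→u)² ≤ ((x→y)^{2n})→u`
for every `n ≥ 1`. -/
theorem stmt_16 {A : Type*} [BasicPseudoHoop A] (u : A) (hu : IsStrongUnit u)
    (hnorm : ∀ F : Set A, IsMaximalFilter F → IsNormalFilter F)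
    (n : ℕ) (hn : 1 ≤ n) (x y : A) :
    PseudoHoop.himp (PseudoHoop.himp x y ^ n) u ^ 2 ≤
        PseudoHoop.himp (PseudoHoop.rimp x y ^ (2 * n)) u ∧
      PseudoHoop.himp (PseudoHoop.rimp x y ^ n) u ^ 2 ≤
        PseudoHoop.himp (PseudoHoop.himp x y ^ (2 * n)) u := by
  have h2 : ∀ c : A, c ^ (2 * n) = c ^ n * c ^ n := fun c => by rw [two_mul, pow_add]
  rw [h2, h2]
  constructor
  · refine main_ineq u hu hnorm _ _ (fun M hM htot => ?_)
    have h := himp_rimp_mod hM (hnorm M hM) htot x y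
    exact ⟨L_pow hM.1 (hnorm M hM) h.1 n, L_pow hM.1 (hnorm M hM) h.2 n⟩
  · refine main_ineq u hu hnorm _ _ (fun M hM htot => ?_)
    have h := himp_rimp_mod hM (hnorm M hM) htot x y
    exact ⟨L_pow hM.1 (hnorm M hM) h.2 n, L_pow hM.1 (hnorm M hM) h.1 n⟩
end
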